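/- arXiv:2208.10581 — 4 statements merged into one kernel-verified Lean document; each statement's English description precedes it below -/
import Mathlib

section
/- Let R, V, ℓ, θ > 0 and let f₀, f₁ : ℝ → ℝ be nonnegative integrable functions with f₀ vanishing outside [0, θ] and ∫_0^θ D²·f₀(D) dD > 0. Define for T > θℓ/(VR) the likelihood ratio L(T | V) = f_T(T | H₁, V)/f_T(T | H₀, V), where f_T(T | Hᵢ, V) = ∫_0^∞ (2D²ℓ²/(R²V²T³))·𝟙{T > Dℓ/(VR)}·fᵢ(D) dD. Then for all T > θℓ/(VR), L(T | V) = (∫_0^{TVR/ℓ} D²·f₁(D) dD)/(∫_0^θ D²·f₀(D) dD), and L(· | V) is a monotone nondecreasing function of T on (θℓ/(VR), ∞). -/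
open MeasureTheory

/-- For `T > θℓ/(VR)`, the likelihood ratio
`L(T|V) = f_T(T|H₁,V)/f_T(T|H₀,V)` equals
`(∫₀^{TVR/ℓ} D² f₁(D) dD)/(∫₀^θ D² f₀(D) dD)`, and `L(·|V)` is
monotone nondecreasing on `(θℓ/(VR), ∞)`. -/
theorem likelihood_ratio_formula_and_monotone
    (R V ℓ θ : ℝ) (hR : 0 < R) (hV : 0 < V) (hℓ : 0 < ℓ) (hθ : 0 < θ)
    (f₀ f₁ : ℝ → ℝ)
    (hf₀int : Integrable f₀) (hf₁int : Integrable f₁)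
    (hf₀nonneg : ∀ D, 0 ≤ f₀ D) (hf₁nonneg : ∀ D, 0 ≤ f₁ D)
    (hf₀supp : ∀ D, D ∉ Set.Icc (0 : ℝ) θ → f₀ D = 0)
    (hden : 0 < ∫ D in (0 : ℝ)..θ, D ^ 2 * f₀ D)
    (fT : (ℝ → ℝ) → ℝ → ℝ)
    (hfT : ∀ f T, fT f T =
      ∫ D in Set.Ioi (0 : ℝ),
        (2 * D ^ 2 * ℓ ^ 2 / (R ^ 2 * V ^ 2 * T ^ 3)) *
          (if D * ℓ / (V * R) < T then 1 else 0) * f D)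
    (L : ℝ → ℝ) (hL : ∀ T, L T = fT f₁ T / fT f₀ T) :
    (∀ T, θ * ℓ / (V * R) < T →
      L T = (∫ D in (0 : ℝ)..(T * V * R / ℓ), D ^ 2 * f₁ D) /
        (∫ D in (0 : ℝ)..θ, D ^ 2 * f₀ D)) ∧
    MonotoneOn L (Set.Ioi (θ * ℓ / (V * R))) := by
  have hVR : 0 < V * R := mul_pos hV hR
  have hlow : 0 < θ * ℓ / (V * R) := by positivity
  have key : ∀ f : ℝ → ℝ, ∀ T, 0 < T → fT f T =
      (2 * ℓ ^ 2 / (R ^ 2 * V ^ 2 * T ^ 3)) *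
        ∫ D in (0 : ℝ)..(T * V * R / ℓ), D ^ 2 * f D := by
    intro f T hT
    have ha : 0 ≤ T * V * R / ℓ := by positivity
    rw [hfT, intervalIntegral.integral_of_le ha, integral_Ioc_eq_integral_Ioo,
      ← integral_const_mul]
    have h1 : Set.Ioo 0 (T * V * R / ℓ) = Set.Ioi 0 ∩ Set.Iio (T * V * R / ℓ) := rfl
    rw [h1, ← setIntegral_indicator measurableSet_Iio]
    congr 1
    funext D
    have hiff : D * ℓ / (V * R) < T ↔ D < T * V * R / ℓ := by
      rw [div_lt_iff₀ hVR, lt_div_iff₀ hℓ, mul_assoc T V R]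
    by_cases h : D < T * V * R / ℓ
    · rw [if_pos (hiff.2 h), Set.indicator_of_mem (Set.mem_Iio.2 h)]
      ring
    · rw [if_neg (fun h' => h (hiff.1 h')),
        Set.indicator_of_notMem (fun h' => h (Set.mem_Iio.1 h'))]
      ring
  have formula : ∀ T, θ * ℓ / (V * R) < T →
      L T = (∫ D in (0 : ℝ)..(T * V * R / ℓ), D ^ 2 * f₁ D) /
        (∫ D in (0 : ℝ)..θ, D ^ 2 * f₀ D) := by
    intro T hT
    have hT0 : 0 < T := hlow.trans hT
    have hθa : θ ≤ T * V * R / ℓ := by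
      rw [le_div_iff₀ hℓ, mul_assoc T V R]
      exact ((div_lt_iff₀ hVR).1 hT).le
    have h0 : (∫ D in (0 : ℝ)..(T * V * R / ℓ), D ^ 2 * f₀ D) =
        ∫ D in (0 : ℝ)..θ, D ^ 2 * f₀ D := by
      rw [intervalIntegral.integral_of_le (hθ.le.trans hθa),
        intervalIntegral.integral_of_le hθ.le]
      refine setIntegral_eq_of_subset_of_forall_diff_eq_zero measurableSet_Ioc
        (Set.Ioc_subset_Ioc_right hθa) ?_
      intro D hD
      rw [hf₀supp D (fun h => hD.2 ⟨hD.1.1, h.2⟩), mul_zero]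
    rw [hL, key f₁ T hT0, key f₀ T hT0, h0]
    have hc : (2 * ℓ ^ 2 / (R ^ 2 * V ^ 2 * T ^ 3)) ≠ 0 := by positivity
    exact mul_div_mul_left _ _ hc
  refine ⟨formula, ?_⟩
  intro S hS T hT hST
  rw [formula S hS, formula T hT]
  have hS0 : 0 < S := hlow.trans hS
  have hT0 : 0 < T := hlow.trans hT
  refine div_le_div_of_nonneg_right ?_ hden.le
  refine intervalIntegral.integral_mono_interval le_rfl (by positivity) (by gcongr) ?_ ?_
  · exact Filter.Eventually.of_forall (fun D => mul_nonneg (sq_nonneg D) (hf₁nonneg D))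
  · exact hf₁int.intervalIntegrable.continuousOn_mul (by fun_prop)
end

section
/- Let R, V, ℓ, θ > 0, let τ ≥ ℓ/R, set the threshold η = τθ/V, and let f₀ : ℝ → ℝ be a nonnegative integrable function vanishing outside [0, θ]. Then the false positive rate P(T > η | H₀, V) = ∫_0^θ (∫_η^∞ 2D²ℓ²/(R²V²T³) dT)·f₀(D) dD equals ∫_0^θ (D²ℓ²/(R²θ²τ²))·f₀(D) dD, a quantity that does not depend on the vehicle speed V. -/
open MeasureTheory

/-- With threshold `η = τθ/V` and `τ ≥ ℓ/R`, the false positive rate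
`∫₀^θ (∫_η^∞ 2D²ℓ²/(R²V²T³) dT) f₀(D) dD` equals
`∫₀^θ (D²ℓ²/(R²θ²τ²)) f₀(D) dD`, which does not depend on `V`. -/
theorem false_positive_rate_independent_of_speed
    (R V ℓ θ τ : ℝ) (hR : 0 < R) (hV : 0 < V) (hℓ : 0 < ℓ) (hθ : 0 < θ)
    (hτ : ℓ / R ≤ τ)
    (η : ℝ) (hη : η = τ * θ / V)
    (f₀ : ℝ → ℝ) (hf₀int : Integrable f₀) (hf₀nonneg : ∀ D, 0 ≤ f₀ D)
    (hf₀supp : ∀ D, D ∉ Set.Icc (0 : ℝ) θ → f₀ D = 0) :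
    (∫ D in (0 : ℝ)..θ,
        (∫ t in Set.Ioi η, 2 * D ^ 2 * ℓ ^ 2 / (R ^ 2 * V ^ 2 * t ^ 3)) * f₀ D) =
      ∫ D in (0 : ℝ)..θ, (D ^ 2 * ℓ ^ 2 / (R ^ 2 * θ ^ 2 * τ ^ 2)) * f₀ D := by
  have hτ0 : 0 < τ := lt_of_lt_of_le (div_pos hℓ hR) hτ
  have hη0 : 0 < η := by rw [hη]; positivity
  have key : ∫ t in Set.Ioi η, t ^ (-3 : ℝ) = 1 / (2 * η ^ 2) := by
    rw [integral_Ioi_rpow_of_lt (by norm_num) hη0]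
    have h : η ^ ((-3 : ℝ) + 1) = (η ^ 2)⁻¹ := by
      rw [show ((-3 : ℝ) + 1) = -((2 : ℕ) : ℝ) by norm_num, Real.rpow_neg hη0.le,
        Real.rpow_natCast]
    rw [h]
    field_simp
    norm_num
  have inner : ∀ D : ℝ, (∫ t in Set.Ioi η, 2 * D ^ 2 * ℓ ^ 2 / (R ^ 2 * V ^ 2 * t ^ 3)) =
      D ^ 2 * ℓ ^ 2 / (R ^ 2 * θ ^ 2 * τ ^ 2) := by
    intro D
    have h1 : (∫ t in Set.Ioi η, 2 * D ^ 2 * ℓ ^ 2 / (R ^ 2 * V ^ 2 * t ^ 3)) =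
        ∫ t in Set.Ioi η, (2 * D ^ 2 * ℓ ^ 2 / (R ^ 2 * V ^ 2)) * t ^ (-3 : ℝ) := by
      refine setIntegral_congr_fun measurableSet_Ioi fun t ht => ?_
      have ht0 : 0 < t := hη0.trans ht
      have h : t ^ (-3 : ℝ) = (t ^ 3)⁻¹ := by
        rw [show (-3 : ℝ) = -((3 : ℕ) : ℝ) by norm_num, Real.rpow_neg ht0.le,
          Real.rpow_natCast]
      simp only [h]
      field_simp
    rw [h1, integral_const_mul, key, hη]
    field_simp
  simp only [inner]
end

section
/- Let R, V, ℓ, θ > 0, let τ > 0, set the threshold η = τθ/V, and let f₁ : ℝ → ℝ be a nonnegative integrable function. Then the false negative rate P(T ≤ η | H₁, V) = ∫_0^{ηVR/ℓ} (∫_{Dℓ/(VR)}^{η} 2D²ℓ²/(R²V²T³) dT)·f₁(D) dD equals ∫_0^{τθR/ℓ} (1 − D²ℓ²/(R²θ²τ²))·f₁(D) dD, a quantity that does not depend on the vehicle speed V. -/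
open MeasureTheory intervalIntegral

/-- With threshold `η = τθ/V`, the false negative rate
`∫₀^{ηVR/ℓ} (∫_{Dℓ/(VR)}^η 2D²ℓ²/(R²V²T³) dT) f₁(D) dD` equals
`∫₀^{τθR/ℓ} (1 − D²ℓ²/(R²θ²τ²)) f₁(D) dD`, which does not depend on `V`. -/
theorem false_negative_rate_independent_of_speed
    (R V ℓ θ τ : ℝ) (hR : 0 < R) (hV : 0 < V) (hℓ : 0 < ℓ) (hθ : 0 < θ)
    (hτ : 0 < τ)
    (η : ℝ) (hη : η = τ * θ / V)
    (f₁ : ℝ → ℝ) (hf₁int : Integrable f₁) (hf₁nonneg : ∀ D, 0 ≤ f₁ D) :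
    (∫ D in (0 : ℝ)..(η * V * R / ℓ),
        (∫ t in (D * ℓ / (V * R))..η, 2 * D ^ 2 * ℓ ^ 2 / (R ^ 2 * V ^ 2 * t ^ 3)) * f₁ D) =
      ∫ D in (0 : ℝ)..(τ * θ * R / ℓ),
        (1 - D ^ 2 * ℓ ^ 2 / (R ^ 2 * θ ^ 2 * τ ^ 2)) * f₁ D := by
  have hηpos : 0 < η := by rw [hη]; positivity
  have hb : η * V * R / ℓ = τ * θ * R / ℓ := by
    rw [hη]; field_simp
  rw [hb]
  apply intervalIntegral.integral_congr_ae
  refine Filter.Eventually.of_forall fun D hD => ?_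
  have hbpos : 0 < τ * θ * R / ℓ := by positivity
  rw [Set.uIoc_of_le hbpos.le] at hD
  have hD0 : 0 < D := hD.1
  have ha : 0 < D * ℓ / (V * R) := by positivity
  have hpos : ∀ t ∈ Set.uIcc (D * ℓ / (V * R)) η, 0 < t := fun t ht =>
    lt_of_lt_of_le (lt_min ha hηpos) ht.1
  have key : (∫ t in (D * ℓ / (V * R))..η, 2 * D ^ 2 * ℓ ^ 2 / (R ^ 2 * V ^ 2 * t ^ 3)) =
      (-(D ^ 2 * ℓ ^ 2 / (R ^ 2 * V ^ 2)) * (η ^ 2)⁻¹) -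
      (-(D ^ 2 * ℓ ^ 2 / (R ^ 2 * V ^ 2)) * ((D * ℓ / (V * R)) ^ 2)⁻¹) := by
    apply intervalIntegral.integral_eq_sub_of_hasDerivAt
      (f := fun t : ℝ => -(D ^ 2 * ℓ ^ 2 / (R ^ 2 * V ^ 2)) * (t ^ 2)⁻¹)
    · intro t ht
      have h0 := hpos t ht
      have h1 := (((hasDerivAt_id t).pow 2).inv (by simp [h0.ne'])).const_mul
        (-(D ^ 2 * ℓ ^ 2 / (R ^ 2 * V ^ 2)))
      refine h1.congr_deriv ?_
      simp
      field_simp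
    · apply ContinuousOn.intervalIntegrable
      apply ContinuousOn.div (by fun_prop) (by fun_prop)
      intro t ht
      have h0 := hpos t ht
      positivity
  rw [key, hη]
  congr 1
  field_simp
  ring
end

section
/- Let R, V, ℓ, D₀ > 0 and let η > 0. If η ≥ D₀ℓ/(VR), then ∫_{D₀ℓ/(VR)}^{η} 2D₀²ℓ²/(R²V²T³) dT = 1 − D₀²ℓ²/(R²V²η²); if η < D₀ℓ/(VR), the probability P(T ≤ η | D₀, V) equals 0. Consequently, for θ, α > 0 and η = θℓ/(VR√α), the false negative rate for a background detail of size D₀ equals max(1 − α·D₀²/θ², 0). -/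
open MeasureTheory intervalIntegral

lemma aux_interval (R V ℓ D₀ : ℝ) (hR : 0 < R) (hV : 0 < V) (hℓ : 0 < ℓ) (hD₀ : 0 < D₀)
    (η : ℝ) (h : D₀ * ℓ / (V * R) ≤ η) :
    (∫ t in (D₀ * ℓ / (V * R))..η, 2 * D₀ ^ 2 * ℓ ^ 2 / (R ^ 2 * V ^ 2 * t ^ 3)) =
          1 - D₀ ^ 2 * ℓ ^ 2 / (R ^ 2 * V ^ 2 * η ^ 2) := by
  have hc : 0 < D₀ * ℓ / (V * R) := by positivity
  have hpos : ∀ t ∈ Set.uIcc (D₀ * ℓ / (V * R)) η, 0 < t := by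
    intro t ht
    rw [Set.uIcc_of_le h] at ht
    exact hc.trans_le ht.1
  have key := intervalIntegral.integral_eq_sub_of_hasDerivAt
    (f := fun t : ℝ => - (D₀ ^ 2 * ℓ ^ 2 / (R ^ 2 * V ^ 2)) * (t ^ 2)⁻¹)
    (f' := fun t : ℝ => 2 * D₀ ^ 2 * ℓ ^ 2 / (R ^ 2 * V ^ 2 * t ^ 3))
    (a := D₀ * ℓ / (V * R)) (b := η) ?_ ?_
  · rw [key]
    have := hc.trans_le h
    field_simp
    ring
  · intro t ht
    have h0 := hpos t ht
    have h1 := (((hasDerivAt_pow 2 t).fun_inv (by positivity)).const_mul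
      (- (D₀ ^ 2 * ℓ ^ 2 / (R ^ 2 * V ^ 2))))
    refine h1.congr_deriv ?_
    push_cast
    field_simp
  · apply ContinuousOn.intervalIntegrable
    apply ContinuousOn.div (by fun_prop) (by fun_prop)
    intro t ht
    have := hpos t ht
    positivity

lemma aux_zero (c η : ℝ) (f : ℝ → ℝ) (h : η ≤ c) :
    (∫ t in Set.Iic η, (if c < t then f t else 0)) = 0 := by
  rw [setIntegral_congr_fun (g := fun _ => (0 : ℝ)) measurableSet_Iic]
  · simp
  · intro t ht
    exact if_neg (not_lt.mpr (le_trans ht h))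

lemma aux_set (c η : ℝ) (f : ℝ → ℝ) (h : c ≤ η) :
    (∫ t in Set.Iic η, (if c < t then f t else 0)) = ∫ t in c..η, f t := by
  have : (fun t => if c < t then f t else 0) = (Set.Ioi c).indicator f := by
    ext t
    simp [Set.indicator_apply]
  rw [this, setIntegral_indicator measurableSet_Ioi, intervalIntegral.integral_of_le h,
    Set.Iic_inter_Ioi]

/-- For a background detail of size `D₀`:
if `η ≥ D₀ℓ/(VR)` then `∫_{D₀ℓ/(VR)}^η 2D₀²ℓ²/(R²V²T³) dT = 1 − D₀²ℓ²/(R²V²η²)`;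
if `η < D₀ℓ/(VR)` then `P(T ≤ η | D₀, V) = 0`; consequently, for the
Neyman–Pearson threshold `η = θℓ/(VR√α)` the false negative rate equals
`max(1 − α·D₀²/θ², 0)`. -/
theorem background_false_negative_rate
    (R V ℓ D₀ : ℝ) (hR : 0 < R) (hV : 0 < V) (hℓ : 0 < ℓ) (hD₀ : 0 < D₀)
    (η : ℝ) (hη : 0 < η) :
    ((D₀ * ℓ / (V * R) ≤ η →
        (∫ t in (D₀ * ℓ / (V * R))..η, 2 * D₀ ^ 2 * ℓ ^ 2 / (R ^ 2 * V ^ 2 * t ^ 3)) =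
          1 - D₀ ^ 2 * ℓ ^ 2 / (R ^ 2 * V ^ 2 * η ^ 2)) ∧
      (η < D₀ * ℓ / (V * R) →
        (∫ t in Set.Iic η,
            (if D₀ * ℓ / (V * R) < t then 2 * D₀ ^ 2 * ℓ ^ 2 / (R ^ 2 * V ^ 2 * t ^ 3)
             else 0)) = 0)) ∧
    (∀ θ α : ℝ, 0 < θ → 0 < α →
      (∫ t in Set.Iic (θ * ℓ / (V * R * Real.sqrt α)),
          (if D₀ * ℓ / (V * R) < t then 2 * D₀ ^ 2 * ℓ ^ 2 / (R ^ 2 * V ^ 2 * t ^ 3)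
           else 0)) = max (1 - α * D₀ ^ 2 / θ ^ 2) 0) := by
  refine ⟨⟨aux_interval R V ℓ D₀ hR hV hℓ hD₀ η, fun h => aux_zero _ _ _ h.le⟩, ?_⟩
  intro θ α hθ hα
  have hs : 0 < Real.sqrt α := Real.sqrt_pos.mpr hα
  have hsq : Real.sqrt α ^ 2 = α := Real.sq_sqrt hα.le
  have hval : α * D₀ ^ 2 / θ ^ 2 = (Real.sqrt α * D₀ / θ) ^ 2 := by
    rw [div_pow, mul_pow, hsq]
  have hη' : θ * ℓ / (V * R * Real.sqrt α) =
      (D₀ * ℓ / (V * R)) / (Real.sqrt α * D₀ / θ) := by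
    field_simp
  have hq : 0 < Real.sqrt α * D₀ / θ := by positivity
  have hc : 0 < D₀ * ℓ / (V * R) := by positivity
  rw [hval]
  rcases le_total (Real.sqrt α * D₀ / θ) 1 with h | h
  · have hle : D₀ * ℓ / (V * R) ≤ θ * ℓ / (V * R * Real.sqrt α) := by
      rw [hη', le_div_iff₀ hq]
      nlinarith
    rw [aux_set _ _ (fun t => 2 * D₀ ^ 2 * ℓ ^ 2 / (R ^ 2 * V ^ 2 * t ^ 3)) hle,
      aux_interval R V ℓ D₀ hR hV hℓ hD₀ _ hle, max_eq_left (by nlinarith)]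
    field_simp
  · have hle : θ * ℓ / (V * R * Real.sqrt α) ≤ D₀ * ℓ / (V * R) := by
      rw [hη', div_le_iff₀ hq]
      nlinarith
    rw [aux_zero _ _ (fun t => 2 * D₀ ^ 2 * ℓ ^ 2 / (R ^ 2 * V ^ 2 * t ^ 3)) hle,
      max_eq_right (by nlinarith)]
end
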